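/- arXiv:2305.05284 — 2 statements merged into one kernel-verified Lean document; each statement's English description precedes it below -/
import Mathlib

section
/- Let Ω be a finite nonempty set, (P_θ)_{θ∈Θ} a nonempty family of probability measures on Ω, and T : Ω → S a statistic that is sufficient for the family. (i) If T is complete, then a statistic E : Ω → ℝ is a similar e-variable if and only if E has Neyman structure with respect to T. (ii) If T is not complete, then there exists a similar e-variable that does not have Neyman structure with respect to T; hence completeness of T is both sufficient and necessary for the equivalence in (i). -/
open Finset

/-- A probability measure on a finite type, given by its mass function. -/
def IsProbability {Ω : Type*} [Fintype Ω] (P : Ω → ℝ) : Prop :=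
  (∀ ω, 0 ≤ P ω) ∧ ∑ ω : Ω, P ω = 1

/-- The probability of the fiber `{T = s}` under `P`. -/
def fiberProb {Ω S : Type*} [Fintype Ω] [DecidableEq S] (P : Ω → ℝ) (T : Ω → S)
    (s : S) : ℝ :=
  ∑ ω ∈ Finset.univ.filter fun ω => T ω = s, P ω

/-- The conditional expectation `E_P[g | T = s]` on a finite space. -/
noncomputable def condExp {Ω S : Type*} [Fintype Ω] [DecidableEq S] (P : Ω → ℝ)
    (T : Ω → S) (g : Ω → ℝ) (s : S) : ℝ :=
  (∑ ω ∈ Finset.univ.filter fun ω => T ω = s, P ω * g ω) / fiberProb P T s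

/-- `T` is sufficient for the family `(P θ)` if conditional expectations given
`T` can be chosen independently of `θ`. -/
def Sufficient {Ω S Θ : Type*} [Fintype Ω] [DecidableEq S] (P : Θ → Ω → ℝ)
    (T : Ω → S) : Prop :=
  ∀ g : Ω → ℝ, ∃ f : S → ℝ, ∀ θ s, 0 < fiberProb (P θ) T s →
    f s = condExp (P θ) T g s

/-- `T` is complete for the family `(P θ)`. -/
def Complete {Ω S Θ : Type*} [Fintype Ω] (P : Θ → Ω → ℝ) (T : Ω → S) : Prop :=
  ∀ f : S → ℝ, (∀ θ, ∑ ω : Ω, P θ ω * f (T ω) = 0) →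
    ∀ θ, ∀ ω, 0 < P θ ω → f (T ω) = 0

/-- `E` has Neyman structure w.r.t. `T`. -/
def NeymanStructure {Ω S Θ : Type*} [Fintype Ω] [DecidableEq S] (P : Θ → Ω → ℝ)
    (T : Ω → S) (E : Ω → ℝ) : Prop :=
  ∀ θ s, 0 < fiberProb (P θ) T s → condExp (P θ) T E s = 1

/-- `E` is a similar e-variable for the family `(P θ)`. -/
def SimilarEVariable {Ω Θ : Type*} [Fintype Ω] (P : Θ → Ω → ℝ) (E : Ω → ℝ) : Prop :=
  (∀ ω, 0 ≤ E ω) ∧ ∀ θ, ∑ ω : Ω, P θ ω * E ω = 1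

theorem fiber_sum_of_condExp {Ω S : Type*} [Fintype Ω] [DecidableEq S] (P : Ω → ℝ)
    (hP : ∀ ω, 0 ≤ P ω) (T : Ω → S) (g : Ω → ℝ) (h : S → ℝ)
    (hh : ∀ s, 0 < fiberProb P T s → h s = condExp P T g s) :
    ∑ ω : Ω, P ω * g ω = ∑ ω : Ω, P ω * h (T ω) := by
  have key : ∀ F : Ω → ℝ, ∑ ω : Ω, F ω = ∑ s ∈ Finset.univ.image T,
      ∑ ω ∈ Finset.univ.filter fun ω => T ω = s, F ω := by
    intro F
    exact (Finset.sum_fiberwise_of_maps_to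
      (fun ω _ => Finset.mem_image_of_mem T (Finset.mem_univ ω)) F).symm
  rw [key, key (fun ω => P ω * h (T ω))]
  refine Finset.sum_congr rfl fun s _ => ?_
  have e : ∑ ω ∈ Finset.univ.filter (fun ω => T ω = s), P ω * h (T ω)
      = fiberProb P T s * h s := by
    rw [fiberProb, Finset.sum_mul]
    refine Finset.sum_congr rfl fun ω hω => ?_
    rw [(Finset.mem_filter.mp hω).2]
  have h0 : 0 ≤ fiberProb P T s := Finset.sum_nonneg fun ω _ => hP ω
  rw [e]
  rcases h0.eq_or_lt with h0 | h0
  · rw [← h0, zero_mul]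
    have hz := (Finset.sum_eq_zero_iff_of_nonneg (fun ω _ => hP ω)).mp h0.symm
    exact Finset.sum_eq_zero fun ω hω => by rw [hz ω hω, zero_mul]
  · rw [hh s h0, condExp, mul_div_cancel₀ _ h0.ne']

theorem neyman_structure_iff_complete {Ω S Θ : Type*} [Fintype Ω] [Nonempty Ω]
    [DecidableEq S] [Nonempty Θ] (P : Θ → Ω → ℝ) (hP : ∀ θ, IsProbability (P θ))
    (T : Ω → S) (hT : Sufficient P T) :
    (Complete P T →
      ∀ E : Ω → ℝ, (∀ ω, 0 ≤ E ω) →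
        (SimilarEVariable P E ↔ NeymanStructure P T E)) ∧
    (¬ Complete P T →
      ∃ E : Ω → ℝ, SimilarEVariable P E ∧ ¬ NeymanStructure P T E) := by
  constructor
  · intro hC E hE
    constructor
    · rintro ⟨_, hE1⟩ θ s hs
      obtain ⟨f, hf⟩ := hT E
      have h0 := hC (fun s => f s - 1) (fun θ => by
        have h1 := fiber_sum_of_condExp (P θ) (hP θ).1 T E f (hf θ)
        simp only [mul_sub, mul_one, Finset.sum_sub_distrib]
        rw [← h1, hE1, (hP θ).2, sub_self]) θ
      obtain ⟨ω, hω, hpos⟩ : ∃ ω ∈ Finset.univ.filter (fun ω => T ω = s), 0 < P θ ω := by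
        by_contra! hcon
        exact absurd hs (not_lt.mpr (Finset.sum_nonpos hcon))
      have h2 := h0 ω hpos
      rw [(Finset.mem_filter.mp hω).2] at h2
      rw [← hf θ s hs]
      linarith
    · intro hN
      refine ⟨hE, fun θ => ?_⟩
      rw [fiber_sum_of_condExp (P θ) (hP θ).1 T E (fun _ => 1) (fun s hs => (hN θ s hs).symm)]
      simpa using (hP θ).2
  · intro hC
    unfold Complete at hC
    push Not at hC
    obtain ⟨f, hf, θ, ω, hpos, hne⟩ := hC
    have hM : 0 ≤ ∑ ω : Ω, |f (T ω)| := Finset.sum_nonneg fun _ _ => abs_nonneg _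
    set M := 1 + ∑ ω : Ω, |f (T ω)| with hMdef
    have hMpos : 0 < M := by linarith
    refine ⟨fun ω => 1 + f (T ω) / M, ⟨fun ω => ?_, fun θ => ?_⟩, fun hN => ?_⟩
    · have h1 : |f (T ω)| ≤ ∑ ω : Ω, |f (T ω)| :=
        Finset.single_le_sum (f := fun ω => |f (T ω)|)
          (fun _ _ => abs_nonneg _) (Finset.mem_univ ω)
      have h2 := neg_abs_le (f (T ω))
      have h3 : -1 ≤ f (T ω) / M := by
        rw [le_div_iff₀ hMpos]
        linarith
      show 0 ≤ 1 + f (T ω) / M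
      linarith
    · simp only [mul_add, mul_one, Finset.sum_add_distrib, ← mul_div_assoc]
      rw [← Finset.sum_div, hf, (hP θ).2]
      simp
    · have hs : 0 < fiberProb (P θ) T (T ω) :=
        Finset.sum_pos' (fun ω _ => (hP θ).1 ω) ⟨ω, by simp, hpos⟩
      have h1 := hN θ (T ω) hs
      have h2 : ∑ ω' ∈ Finset.univ.filter (fun ω' => T ω' = T ω), P θ ω' * (1 + f (T ω') / M)
          = fiberProb (P θ) T (T ω) * (1 + f (T ω) / M) := by
        rw [fiberProb, Finset.sum_mul]
        refine Finset.sum_congr rfl fun ω' hω => ?_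
        rw [(Finset.mem_filter.mp hω).2]
      rw [condExp, h2, mul_div_cancel_left₀ _ hs.ne'] at h1
      have h3 : f (T ω) / M = 0 := by linarith
      exact (div_ne_zero hne hMpos.ne') h3
end

section
/- Let Ω be a finite nonempty set, (P_θ)_{θ∈Θ} a nonempty family of probability measures on Ω, and T : Ω → S a statistic that is sufficient for the family. (i) If T is supercomplete, then a nonnegative statistic E : Ω → [0,∞) is an e-variable for the family if and only if E has one-sided Neyman structure with respect to T. (ii) If T is not supercomplete, then there exists an e-variable for the family that does not have one-sided Neyman structure with respect to T; hence supercompleteness of T is both sufficient and necessary for the equivalence in (i). -/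
open Finset

/-- `T` is supercomplete for the family `(P θ)`. -/
def Supercomplete {Ω S Θ : Type*} [Fintype Ω] (P : Θ → Ω → ℝ) (T : Ω → S) : Prop :=
  ∀ f : S → ℝ, (∀ θ, ∑ ω : Ω, P θ ω * f (T ω) ≤ 0) →
    ∀ θ, ∀ ω, 0 < P θ ω → f (T ω) ≤ 0

/-- `E` has one-sided Neyman structure w.r.t. `T`. -/
def OneSidedNeymanStructure {Ω S Θ : Type*} [Fintype Ω] [DecidableEq S]
    (P : Θ → Ω → ℝ) (T : Ω → S) (E : Ω → ℝ) : Prop :=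
  ∀ θ s, 0 < fiberProb (P θ) T s → condExp (P θ) T E s ≤ 1

/-- `E` is an e-variable for the family `(P θ)`. -/
def EVariable {Ω Θ : Type*} [Fintype Ω] (P : Θ → Ω → ℝ) (E : Ω → ℝ) : Prop :=
  (∀ ω, 0 ≤ E ω) ∧ ∀ θ, ∑ ω : Ω, P θ ω * E ω ≤ 1

theorem aux_sum_le {Ω S : Type*} [Fintype Ω] [DecidableEq S] (T : Ω → S) (A B : Ω → ℝ)
    (h : ∀ s, ∑ ω ∈ Finset.univ.filter (fun ω => T ω = s), A ω
      ≤ ∑ ω ∈ Finset.univ.filter (fun ω => T ω = s), B ω) :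
    ∑ ω, A ω ≤ ∑ ω, B ω := by
  have hm : ∀ ω ∈ (Finset.univ : Finset Ω), T ω ∈ Finset.univ.image T :=
    fun ω _ => Finset.mem_image_of_mem T (Finset.mem_univ ω)
  rw [← Finset.sum_fiberwise_of_maps_to hm A, ← Finset.sum_fiberwise_of_maps_to hm B]
  exact Finset.sum_le_sum fun s _ => h s

theorem aux_null {Ω S : Type*} [Fintype Ω] [DecidableEq S] (P : Ω → ℝ) (hP : ∀ ω, 0 ≤ P ω)
    (T : Ω → S) (s : S) (h : ¬ 0 < fiberProb P T s) (g : Ω → ℝ) :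
    ∑ ω ∈ Finset.univ.filter (fun ω => T ω = s), P ω * g ω = 0 := by
  have h0 : fiberProb P T s = 0 :=
    le_antisymm (not_lt.mp h) (Finset.sum_nonneg fun ω _ => hP ω)
  have h1 := (Finset.sum_eq_zero_iff_of_nonneg (fun ω _ => hP ω)).mp h0
  exact Finset.sum_eq_zero fun ω hω => by rw [h1 ω hω, zero_mul]

theorem aux_const {Ω S : Type*} [Fintype Ω] [DecidableEq S] (P : Ω → ℝ)
    (T : Ω → S) (s : S) (f : S → ℝ) :
    ∑ ω ∈ Finset.univ.filter (fun ω => T ω = s), P ω * f (T ω) = f s * fiberProb P T s := by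
  unfold fiberProb
  rw [Finset.mul_sum]
  refine Finset.sum_congr rfl fun ω hω => ?_
  rw [(Finset.mem_filter.mp hω).2, mul_comm]

theorem one_sided_neyman_structure_iff_supercomplete {Ω S Θ : Type*} [Fintype Ω]
    [Nonempty Ω] [DecidableEq S] [Nonempty Θ] (P : Θ → Ω → ℝ)
    (hP : ∀ θ, IsProbability (P θ)) (T : Ω → S) (hT : Sufficient P T) :
    (Supercomplete P T →
      ∀ E : Ω → ℝ, (∀ ω, 0 ≤ E ω) →
        (EVariable P E ↔ OneSidedNeymanStructure P T E)) ∧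
    (¬ Supercomplete P T →
      ∃ E : Ω → ℝ, EVariable P E ∧ ¬ OneSidedNeymanStructure P T E) := by
  constructor
  · intro hS E hE
    constructor
    · intro hev θ s hs
      obtain ⟨f, hf⟩ := hT E
      have key : ∀ θ, ∑ ω, P θ ω * f (T ω) ≤ ∑ ω, P θ ω * E ω := by
        intro θ
        refine aux_sum_le T _ _ fun s => ?_
        by_cases h : 0 < fiberProb (P θ) T s
        · rw [aux_const, hf θ s h, condExp, div_mul_cancel₀ _ h.ne']
        · rw [aux_null _ (hP θ).1 T s h E,
            aux_null _ (hP θ).1 T s h (fun ω => f (T ω))]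
      have h1 := hS (fun s => f s - 1) (by
        intro θ
        have h2 := hev.2 θ
        have h3 := key θ
        have h4 := (hP θ).2
        simp only [mul_sub, mul_one, Finset.sum_sub_distrib]
        linarith) θ
      obtain ⟨ω, hω, hpos⟩ : ∃ ω ∈ Finset.univ.filter (fun ω => T ω = s), 0 < P θ ω := by
        by_contra hcon
        push Not at hcon
        exact absurd hs (not_lt.mpr (Finset.sum_nonpos hcon))
      have h5 := h1 ω hpos
      rw [(Finset.mem_filter.mp hω).2] at h5
      rw [← hf θ s hs]
      linarith
    · intro hN
      refine ⟨hE, fun θ => ?_⟩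
      rw [← (hP θ).2]
      refine aux_sum_le T _ _ fun s => ?_
      by_cases h : 0 < fiberProb (P θ) T s
      · exact (div_le_one h).mp (hN θ s h)
      · rw [aux_null _ (hP θ).1 T s h E]
        exact Finset.sum_nonneg fun ω _ => (hP θ).1 ω
  · intro hS
    unfold Supercomplete at hS
    push Not at hS
    obtain ⟨f, hf, θ, ω₀, hpos, hfpos⟩ := hS
    have hb : ∃ M : ℝ, 0 < M ∧ ∀ ω, -M ≤ f (T ω) := by
      refine ⟨1 + ∑ ω, |f (T ω)|, ?_, fun ω => ?_⟩
      · have := Finset.sum_nonneg (s := Finset.univ) (fun ω _ => abs_nonneg (f (T ω)))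
        linarith
      · have := Finset.single_le_sum (f := fun ω => |f (T ω)|)
          (fun ω _ => abs_nonneg (f (T ω))) (Finset.mem_univ ω)
        have h2 := neg_abs_le (f (T ω))
        linarith
    obtain ⟨M, hM, hb⟩ := hb
    refine ⟨fun ω => (fun s => 1 + f s / M) (T ω), ⟨fun ω => ?_, fun θ => ?_⟩, fun hN => ?_⟩
    · have : -1 ≤ f (T ω) / M := by
        rw [le_div_iff₀ hM]
        linarith [hb ω]
      simp only
      linarith
    · simp only [mul_add, mul_one, Finset.sum_add_distrib, (hP θ).2, ← mul_div_assoc,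
        ← Finset.sum_div]
      have := div_nonpos_of_nonpos_of_nonneg (hf θ) hM.le
      linarith
    · have hs : 0 < fiberProb (P θ) T (T ω₀) :=
        lt_of_lt_of_le hpos (Finset.single_le_sum (fun ω _ => (hP θ).1 ω)
          (Finset.mem_filter.mpr ⟨Finset.mem_univ ω₀, rfl⟩))
      have h := hN θ (T ω₀) hs
      rw [condExp, aux_const (P θ) T (T ω₀) (fun s => 1 + f s / M), mul_div_cancel_right₀ _ hs.ne'] at h
      have := div_pos hfpos hM
      linarith
end
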